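/- The Johnson graph Γ⁴₆ (vertices the 4-element subsets of {1,…,6}, adjacency meaning intersection of size 3) has no exact 2-factor; that is, there is no exact spanning 2-regular subgraph of Γ⁴₆. -/

import Mathlib

/-- The closed neighborhood `N[v]` of a vertex (the 1-sphere centered at `v`). -/
def closedNbr {V : Type*} (G : SimpleGraph V) (v : V) : Set V :=
  insert v (G.neighborSet v)

/-- A 1-sphere packing: a set of vertices with pairwise disjoint closed neighborhoods. -/
def IsSpherePacking {V : Type*} (G : SimpleGraph V) (J : Set V) : Prop :=
  J.Pairwise fun u v => Disjoint (closedNbr G u) (closedNbr G v)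

/-- An efficient dominating set: an independent set such that every vertex outside it
is adjacent to exactly one of its members. -/
def IsEDS {V : Type*} (G : SimpleGraph V) (J : Set V) : Prop :=
  (∀ u ∈ J, ∀ v ∈ J, ¬ G.Adj u v) ∧ ∀ v, v ∉ J → ∃! u, u ∈ J ∧ G.Adj v u

/-- An efficient dominating set of the subgraph of `G` induced on the set `S`. -/
def IsEDSOn {V : Type*} (G : SimpleGraph V) (S J : Set V) : Prop :=
  J ⊆ S ∧ (∀ u ∈ J, ∀ v ∈ J, ¬ G.Adj u v) ∧
    ∀ v ∈ S, v ∉ J → ∃! u, u ∈ J ∧ G.Adj v u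

/-- The Cayley graph `X(Sₙ, τ)` of the symmetric group on `Fin n` with connection set
the transpositions coming from the edges of the graph `τ`. -/
def cayley {n : ℕ} (τ : SimpleGraph (Fin n)) : SimpleGraph (Equiv.Perm (Fin n)) :=
  SimpleGraph.fromRel fun g h => ∃ i j : Fin n, τ.Adj i j ∧ h * g⁻¹ = Equiv.swap i j

/-- The double-star tree `τ³_{r,t}` on `{1,…,r+t}` (0-indexed on `Fin (r+t)`): edges
`{i, r}` for `1 ≤ i ≤ r-1`, the central edge `{r, r+1}`, and `{r+1, j}` for `r+2 ≤ j ≤ n`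
(1-indexed), i.e. 0-indexed: `{i, r-1}` for `i < r-1`, `{r-1, r}`, and `{r, j}` for `r < j`. -/
def doubleStar (r t : ℕ) : SimpleGraph (Fin (r + t)) :=
  SimpleGraph.fromRel fun i j =>
    ((i : ℕ) < r - 1 ∧ (j : ℕ) = r - 1) ∨ ((i : ℕ) = r - 1 ∧ (j : ℕ) = r) ∨
      ((i : ℕ) = r ∧ r < (j : ℕ))

/-- `X³_{r,t}`, the Cayley graph of the double-star tree. -/
def X3 (r t : ℕ) : SimpleGraph (Equiv.Perm (Fin (r + t))) :=
  cayley (doubleStar r t)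

/-- The star Cayley graph on `S_m` with center `m` (0-indexed: center `m-1`):
connection set the transpositions `(i, m-1)` with `i < m-1`. -/
def starGraph (m : ℕ) : SimpleGraph (Equiv.Perm (Fin m)) :=
  SimpleGraph.fromRel fun g h =>
    ∃ i j : Fin m, (i : ℕ) < m - 1 ∧ (j : ℕ) = m - 1 ∧ h * g⁻¹ = Equiv.swap i j

/-- A star-like Cayley graph on `Equiv.Perm (Fin n)` with center `c` and leaf set `S`:
connection set the transpositions `(i, c)` with `i ∈ S`. -/
def starAt {n : ℕ} (c : Fin n) (S : Set (Fin n)) : SimpleGraph (Equiv.Perm (Fin n)) :=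
  SimpleGraph.fromRel fun g h => ∃ i ∈ S, h * g⁻¹ = Equiv.swap i c

/-- The Johnson graph `Γ^r_n`: vertices the `r`-subsets of `{1,…,n}`, adjacency
meaning intersection of size `r-1`. -/
def johnson (n r : ℕ) : SimpleGraph {A : Finset (Fin n) // A.card = r} :=
  SimpleGraph.fromRel fun A B => (A.val ∩ B.val).card = r - 1

/-- A subgraph `Ψ` of `Γ^r_n` is exact if (a) any two of its edges incident to a common
vertex have colors sharing exactly `r-2` elements, and (b) the vertices of any path of
length 2 in `Ψ` involve exactly `r+2` elements. -/
def IsExact {n r : ℕ} (Ψ : SimpleGraph {A : Finset (Fin n) // A.card = r}) : Prop :=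
  (∀ u v w, Ψ.Adj u v → Ψ.Adj u w → v ≠ w →
    ((u.val ∩ v.val) ∩ (u.val ∩ w.val)).card = r - 2) ∧
  (∀ u v w, Ψ.Adj u v → Ψ.Adj v w → u ≠ w →
    (u.val ∪ v.val ∪ w.val).card = r + 2)

/-- A unicyclic caterpillar: a connected graph with exactly one cycle (for a finite
connected graph, `#edges = #vertices`) such that deleting its vertices of degree 1
leaves precisely that cycle (the subgraph induced on the vertices of degree at least 2
is a (connected, 2-regular) cycle). -/
def IsUnicyclicCaterpillar {V : Type*} (H : SimpleGraph V) : Prop :=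
  H.Connected ∧ H.edgeSet.ncard = Nat.card V ∧
  (H.induce {v | 2 ≤ (H.neighborSet v).ncard}).Connected ∧
  ∀ v, ((H.induce {v | 2 ≤ (H.neighborSet v).ncard}).neighborSet v).ncard = 2

/-- A nest of `Γ^r_n`: an exact spanning subgraph of maximum degree at most 3 each of
whose connected components is a unicyclic caterpillar. -/
def HasNest (n r : ℕ) : Prop :=
  ∃ Ψ : SimpleGraph {A : Finset (Fin n) // A.card = r},
    Ψ ≤ johnson n r ∧ IsExact Ψ ∧ (∀ v, (Ψ.neighborSet v).ncard ≤ 3) ∧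
    ∀ c : Ψ.ConnectedComponent, IsUnicyclicCaterpillar (Ψ.induce c.supp)

/-- `P_r` from Theorem 7 of the paper. -/
def Pnum (r : ℕ) : ℕ :=
  if r % 2 = 1 then Nat.choose (2 * r) r - 2 ^ r
  else Nat.choose (2 * r) r - 2 ^ r - Nat.choose r (r / 2)

/-- The Young subgroup `H = S_{{1,…,r}} × S_{{r+1,…,n}}` as a subset of `S_{r+t}`. -/
def youngH (r t : ℕ) : Set (Equiv.Perm (Fin (r + t))) :=
  {σ | (⇑σ) '' {i : Fin (r + t) | (i : ℕ) < r} = {i : Fin (r + t) | (i : ℕ) < r}}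

/-- The edges from a cyclically ordered vertex list. -/
def cycleEdges {α : Type*} (l : List α) : List (α × α) := l.zip (l.rotate 1)


/-- A neighbor of `v` in the Johnson graph containing a point `x ∉ v` has no further point
outside `v`. -/
lemma johnson_adj_subset_insert {n r : ℕ}
    {v a : {A : Finset (Fin n) // A.card = r}} (h : (johnson n r).Adj v a)
    {x : Fin n} (hxv : x ∉ v.val) (hxa : x ∈ a.val) : a.val ⊆ insert x v.val := by
  have hc : (v.val ∩ a.val).card = r - 1 := by
    rcases h.2 with h | h
    · exact h
    · rwa [Finset.inter_comm]
  have heq : insert x (v.val ∩ a.val) = a.val := by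
    apply Finset.eq_of_subset_of_card_le
    · exact Finset.insert_subset hxa Finset.inter_subset_right
    · rw [Finset.card_insert_of_notMem (by simp [hxv]), hc, a.2]
      omega
  rw [← heq]
  exact Finset.insert_subset_insert _ Finset.inter_subset_left

/-- In an exact 2-factor of `Γ^r_{r+2}`, a vertex avoiding the point `x` has exactly one
neighbor avoiding `x`. -/
lemma existsUnique_adj_notMem_of_isExact {r : ℕ}
    {Ψ : SimpleGraph {A : Finset (Fin (r + 2)) // A.card = r}} (hle : Ψ ≤ johnson (r + 2) r)
    (hex : IsExact Ψ) (hdeg : ∀ v, (Ψ.neighborSet v).ncard = 2) (x : Fin (r + 2))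
    {v : {A : Finset (Fin (r + 2)) // A.card = r}} (hv : x ∉ v.val) :
    ∃! w, Ψ.Adj v w ∧ x ∉ w.val := by
  obtain ⟨a, b, hab, hN⟩ := Set.ncard_eq_two.mp (hdeg v)
  have hadj (w) : Ψ.Adj v w ↔ w = a ∨ w = b := by
    rw [← SimpleGraph.mem_neighborSet, hN]
    simp
  have ha : Ψ.Adj v a := (hadj a).2 (.inl rfl)
  have hb : Ψ.Adj v b := (hadj b).2 (.inr rfl)
  have hcard := hex.2 a v b ha.symm hb hab
  have hor : x ∈ a.val ∨ x ∈ b.val := by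
    have huniv : a.val ∪ v.val ∪ b.val = Finset.univ := by
      rw [← Finset.card_eq_iff_eq_univ, hcard, Fintype.card_fin]
    have hx := Finset.mem_univ x
    rw [← huniv] at hx
    simpa [hv] using hx
  have hnand : ¬ (x ∈ a.val ∧ x ∈ b.val) := by
    rintro ⟨hxa, hxb⟩
    have hsub : a.val ∪ v.val ∪ b.val ⊆ insert x v.val :=
      Finset.union_subset (Finset.union_subset
        (johnson_adj_subset_insert (hle ha) hv hxa) (Finset.subset_insert _ _))
        (johnson_adj_subset_insert (hle hb) hv hxb)
    have hcard_le := Finset.card_le_card hsub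
    rw [hcard, Finset.card_insert_of_notMem hv, v.2] at hcard_le
    omega
  rcases hor with hxa | hxb
  · refine ⟨b, ⟨hb, fun h => hnand ⟨hxa, h⟩⟩, ?_⟩
    rintro w ⟨hw, hxw⟩
    rcases (hadj w).1 hw with rfl | rfl
    · exact absurd hxa hxw
    · rfl
  · refine ⟨a, ⟨ha, fun h => hnand ⟨h, hxb⟩⟩, ?_⟩
    rintro w ⟨hw, hxw⟩
    rcases (hadj w).1 hw with rfl | rfl
    · rfl
    · exact absurd hxb hxw

/-- the Johnson graph `Γ⁴₆` has no exact 2-factor. -/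
theorem johnson_6_4_no_exact_two_factor :
    ¬ ∃ Ψ : SimpleGraph {A : Finset (Fin 6) // A.card = 4},
      Ψ ≤ johnson 6 4 ∧ IsExact Ψ ∧ ∀ v, (Ψ.neighborSet v).ncard = 2 := by
  classical
  rintro ⟨Ψ, hle, hex, hdeg⟩
  let H := Ψ.induce {A | (0 : Fin 6) ∉ A.val}
  have hH (v) : H.degree v = 1 := by
    rw [SimpleGraph.degree_eq_one_iff_existsUnique_adj]
    obtain ⟨w, ⟨hw, hxw⟩, huniq⟩ :=
      existsUnique_adj_notMem_of_isExact hle hex hdeg 0 v.2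
    exact ⟨⟨w, hxw⟩, hw, fun u hu => Subtype.ext (huniq u ⟨hu, u.2⟩)⟩
  have hsum := H.sum_degrees_eq_twice_card_edges
  have hcard : Fintype.card {A : {A : Finset (Fin 6) // A.card = 4} // (0 : Fin 6) ∉ A.val} = 5 := by
    decide +kernel
  simp only [hH, Finset.sum_const, Finset.card_univ, smul_eq_mul, mul_one] at hsum
  have hodd : 5 = 2 * H.edgeFinset.card := by
    rw [← hsum]
    exact hcard.symm.trans (Fintype.card_congr (Equiv.refl _))
  omega
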